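/- For any p⃗ ∈ (0,1)^m and any nondecreasing, nonconstant score vector s = (s_0,…,s_k) ∈ ℝ^{k+1}, the set of k-committees maximizing the expected Thiele score under the independent approval distribution π_{p⃗} is exactly top_k(p⃗): argmax_{W ∈ C_k} E_{A∼π_{p⃗}}[ s_{|A∩W|} ] = top_k(p⃗). In particular, for every W₁ ∈ top_k(p⃗) and W₂ ∈ C_k∖top_k(p⃗), E_{A∼π_{p⃗}}[ s_{|A∩W₁|} ] > E_{A∼π_{p⃗}}[ s_{|A∩W₂|} ], and any two committees in top_k(p⃗) have equal expected score. -/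

import Mathlib

/-- Probability of an approval set `A` under the independent approval distribution
`π_{p⃗}`: each alternative `i` is approved independently with probability `p i`. -/
noncomputable def iadProb (m : ℕ) (p : Fin m → ℝ) (A : Finset (Fin m)) : ℝ :=
  (∏ i ∈ A, p i) * ∏ i ∈ Aᶜ, (1 - p i)

/-- Expected Thiele score of committee `W` under `π_{p⃗}`:
`E_{A∼π_{p⃗}}[ s_{|A∩W|} ] = Σ_{A ⊆ 𝒜} π_{p⃗}(A)·s_{|A∩W|}`. -/
noncomputable def expThiele (m : ℕ) (p : Fin m → ℝ) (s : ℕ → ℝ)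
    (W : Finset (Fin m)) : ℝ :=
  ∑ A : Finset (Fin m), iadProb m p A * s ((A ∩ W).card)

open Classical in
/-- The set `top_k(p⃗)` of `k`-committees whose approval probabilities dominate all
others. -/
noncomputable def topk (m k : ℕ) (p : Fin m → ℝ) : Finset (Finset (Fin m)) :=
  Finset.univ.filter fun W : Finset (Fin m) => W.card = k ∧
    ∀ i ∈ W, ∀ j : Fin m, j ∉ W → p j ≤ p i

/-- Probability under `π_{p⃗}` that `A` is the approval set on the alternatives other than `i`. -/
noncomputable def iadProbErase (m : ℕ) (p : Fin m → ℝ) (i : Fin m) (A : Finset (Fin m)) : ℝ :=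
  (∏ j ∈ A, p j) * ∏ j ∈ Aᶜ.erase i, (1 - p j)

lemma iadProb_eq_of_notMem {m : ℕ} (p : Fin m → ℝ) {i : Fin m} {A : Finset (Fin m)}
    (hi : i ∉ A) : iadProb m p A = (1 - p i) * iadProbErase m p i A := by
  unfold iadProb iadProbErase
  rw [← Finset.mul_prod_erase Aᶜ (fun j => 1 - p j) (Finset.mem_compl.2 hi)]
  ring

lemma iadProb_insert {m : ℕ} (p : Fin m → ℝ) {i : Fin m} {A : Finset (Fin m)}
    (hi : i ∉ A) : iadProb m p (insert i A) = p i * iadProbErase m p i A := by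
  unfold iadProb iadProbErase
  rw [Finset.prod_insert hi, Finset.compl_insert]
  ring

lemma sum_finset_eq_sum_powerset_erase {m : ℕ} (i : Fin m) (f : Finset (Fin m) → ℝ) :
    ∑ A, f A = ∑ A ∈ (Finset.univ.erase i).powerset, (f A + f (insert i A)) := by
  rw [Finset.sum_add_distrib, ← Finset.sum_powerset_insert (Finset.notMem_erase i _),
    Finset.insert_erase (Finset.mem_univ i), Finset.powerset_univ]

lemma expThiele_eq_sum_erase {m : ℕ} (p : Fin m → ℝ) (s : ℕ → ℝ) {i : Fin m}
    {U : Finset (Fin m)} (hi : i ∉ U) :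
    expThiele m p s U = ∑ A ∈ (Finset.univ.erase i).powerset,
      iadProbErase m p i A * s (A ∩ U).card := by
  rw [expThiele, sum_finset_eq_sum_powerset_erase i]
  refine Finset.sum_congr rfl fun A hA => ?_
  have hiA : i ∉ A := fun h => Finset.notMem_erase i _ (Finset.mem_powerset.1 hA h)
  rw [iadProb_eq_of_notMem p hiA, iadProb_insert p hiA, Finset.insert_inter_of_notMem hi]
  ring

/-- Adding an alternative raises the expected score by its approval probability times the expected
marginal score. -/
lemma expThiele_insert {m : ℕ} (p : Fin m → ℝ) (s : ℕ → ℝ) {i : Fin m}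
    {U : Finset (Fin m)} (hi : i ∉ U) :
    expThiele m p s (insert i U) =
      expThiele m p s U + p i * expThiele m p (fun n => s (n + 1) - s n) U := by
  rw [expThiele_eq_sum_erase p s hi, expThiele_eq_sum_erase p _ hi, expThiele,
    sum_finset_eq_sum_powerset_erase i, Finset.mul_sum, ← Finset.sum_add_distrib]
  refine Finset.sum_congr rfl fun A hA => ?_
  have hiA : i ∉ A := fun h => Finset.notMem_erase i _ (Finset.mem_powerset.1 hA h)
  rw [iadProb_eq_of_notMem p hiA, iadProb_insert p hiA, Finset.inter_insert_of_notMem hiA,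
    ← Finset.insert_inter_distrib,
    Finset.card_insert_of_notMem fun h => hiA (Finset.mem_inter.1 h).1]
  ring

lemma iadProb_pos {m : ℕ} {p : Fin m → ℝ} (hp : ∀ i, 0 < p i ∧ p i < 1)
    (A : Finset (Fin m)) : 0 < iadProb m p A :=
  mul_pos (Finset.prod_pos fun i _ => (hp i).1)
    (Finset.prod_pos fun i _ => sub_pos.2 (hp i).2)

lemma expThiele_pos {m : ℕ} {p : Fin m → ℝ} (hp : ∀ i, 0 < p i ∧ p i < 1)
    {d : ℕ → ℝ} {U : Finset (Fin m)} (hd : ∀ n ≤ U.card, 0 ≤ d n)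
    (hpos : ∃ n ≤ U.card, 0 < d n) : 0 < expThiele m p d U := by
  obtain ⟨n, hn, hdn⟩ := hpos
  obtain ⟨A, hAU, rfl⟩ := Finset.exists_subset_card_eq hn
  refine Finset.sum_pos' (fun B _ => mul_nonneg (iadProb_pos hp B).le
    (hd _ (Finset.card_le_card Finset.inter_subset_right))) ⟨A, Finset.mem_univ A, ?_⟩
  rw [Finset.inter_eq_left.2 hAU]
  exact mul_pos (iadProb_pos hp A) hdn

/-- Swapping `j ∈ W` for `i ∉ W` changes the expected score by a positive multiple of
`p i - p j`. -/
lemma exists_expThiele_swap {m k : ℕ} {p : Fin m → ℝ} (hp : ∀ i, 0 < p i ∧ p i < 1)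
    {s : ℕ → ℝ} (hmono : ∀ i < k, s i ≤ s (i + 1)) (hnc : ∃ i < k, s i ≠ s (i + 1))
    {W : Finset (Fin m)} (hW : W.card = k) {i j : Fin m} (hj : j ∈ W) (hi : i ∉ W) :
    ∃ c > 0, expThiele m p s (insert i (W.erase j)) = expThiele m p s W + (p i - p j) * c := by
  have hcard : (W.erase j).card + 1 = k := hW ▸ Finset.card_erase_add_one hj
  refine ⟨expThiele m p (fun n => s (n + 1) - s n) (W.erase j), expThiele_pos hp
    (fun n hn => sub_nonneg.2 (hmono n (by omega))) ?_, ?_⟩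
  · obtain ⟨n, hn, hne⟩ := hnc
    exact ⟨n, by omega, sub_pos.2 ((hmono n hn).lt_of_ne hne)⟩
  · have h := expThiele_insert p s (Finset.notMem_erase j W)
    rw [Finset.insert_erase hj] at h
    rw [h, expThiele_insert p s fun h => hi (Finset.mem_of_mem_erase h)]
    ring

lemma card_insert_erase {m : ℕ} {W : Finset (Fin m)} {i j : Fin m} (hj : j ∈ W) (hi : i ∉ W) :
    (insert i (W.erase j)).card = W.card := by
  rw [Finset.card_insert_of_notMem fun h => hi (Finset.mem_of_mem_erase h),
    Finset.card_erase_add_one hj]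

lemma mem_topk {m k : ℕ} {p : Fin m → ℝ} {W : Finset (Fin m)} :
    W ∈ topk m k p ↔ W.card = k ∧ ∀ i ∈ W, ∀ j : Fin m, j ∉ W → p j ≤ p i := by
  simp [topk]

lemma expThiele_le_of_mem_topk {m k : ℕ} {p : Fin m → ℝ} (hp : ∀ i, 0 < p i ∧ p i < 1)
    {s : ℕ → ℝ} (hmono : ∀ i < k, s i ≤ s (i + 1)) (hnc : ∃ i < k, s i ≠ s (i + 1))
    {W W' : Finset (Fin m)} (hW : W ∈ topk m k p) (hW' : W'.card = k) :
    expThiele m p s W' ≤ expThiele m p s W := by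
  obtain ⟨hcard, htop⟩ := mem_topk.1 hW
  induction h : (W \ W').card generalizing W' with
  | zero =>
    rw [Finset.card_eq_zero, Finset.sdiff_eq_empty_iff_subset] at h
    rw [Finset.eq_of_subset_of_card_le h (by omega)]
  | succ n ih =>
    obtain ⟨i, hi⟩ : (W \ W').Nonempty := Finset.card_pos.1 (by omega)
    obtain ⟨j, hj⟩ : (W' \ W).Nonempty := Finset.card_pos.1 (by
      rw [Finset.card_sdiff_comm (hW'.trans hcard.symm)]; omega)
    have hi' := hi
    rw [Finset.mem_sdiff] at hi hj
    obtain ⟨c, hc, hswap⟩ := exists_expThiele_swap hp hmono hnc hW' hj.1 hi.2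
    have hsdiff : W \ insert i (W'.erase j) = (W \ W').erase i := by
      ext x
      simp only [Finset.mem_sdiff, Finset.mem_insert, Finset.mem_erase]
      grind
    have hle := ih ((card_insert_erase hj.1 hi.2).trans hW') (by
      rw [hsdiff, Finset.card_erase_of_mem hi', h, Nat.add_sub_cancel])
    have := mul_nonneg (sub_nonneg.2 (htop i hi.1 j hj.2)) hc.le
    linarith

lemma exists_expThiele_lt_of_notMem_topk {m k : ℕ} {p : Fin m → ℝ}
    (hp : ∀ i, 0 < p i ∧ p i < 1) {s : ℕ → ℝ} (hmono : ∀ i < k, s i ≤ s (i + 1))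
    (hnc : ∃ i < k, s i ≠ s (i + 1)) {W : Finset (Fin m)} (hW : W.card = k)
    (hnot : W ∉ topk m k p) :
    ∃ W' : Finset (Fin m), W'.card = k ∧ expThiele m p s W < expThiele m p s W' := by
  rw [mem_topk] at hnot
  push Not at hnot
  obtain ⟨j, hj, i, hi, hlt⟩ := hnot hW
  obtain ⟨c, hc, hswap⟩ := exists_expThiele_swap hp hmono hnc hW hj hi
  refine ⟨_, (card_insert_erase hj hi).trans hW, ?_⟩
  have := mul_pos (sub_pos.2 hlt) hc
  linarith

/-- for any `p⃗ ∈ (0,1)^m` and any nondecreasing, nonconstant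
score vector `s`, the `k`-committees maximizing the expected Thiele score under
`π_{p⃗}` are exactly `top_k(p⃗)`; in particular every committee of `top_k(p⃗)` has
strictly larger expected score than every `k`-committee outside `top_k(p⃗)`, and any
two committees in `top_k(p⃗)` have equal expected scores. -/
theorem expected_thiele_argmax (m k : ℕ) (hk : 1 ≤ k) (hkm : k ≤ m)
    (p : Fin m → ℝ) (hp : ∀ i, 0 < p i ∧ p i < 1)
    (s : ℕ → ℝ) (hmono : ∀ i < k, s i ≤ s (i + 1))
    (hnc : ∃ i < k, s i ≠ s (i + 1)) :
    ({W : Finset (Fin m) | W.card = k ∧ ∀ W' : Finset (Fin m), W'.card = k →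
        expThiele m p s W' ≤ expThiele m p s W}
      = (topk m k p : Set (Finset (Fin m)))) ∧
    (∀ W₁ ∈ topk m k p, ∀ W₂ : Finset (Fin m), W₂.card = k →
      W₂ ∉ topk m k p → expThiele m p s W₂ < expThiele m p s W₁) ∧
    (∀ W₁ ∈ topk m k p, ∀ W₂ ∈ topk m k p,
      expThiele m p s W₁ = expThiele m p s W₂) := by
  refine ⟨?_, fun W₁ h₁ W₂ hW₂ h₂ => ?_, fun W₁ h₁ W₂ h₂ => ?_⟩
  · ext W
    rw [Set.mem_ofPred_eq, Finset.mem_coe]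
    refine ⟨fun ⟨hW, hmax⟩ => ?_, fun h => ⟨(mem_topk.1 h).1, fun W' hW' =>
      expThiele_le_of_mem_topk hp hmono hnc h hW'⟩⟩
    by_contra hnot
    obtain ⟨W', hW', hlt⟩ := exists_expThiele_lt_of_notMem_topk hp hmono hnc hW hnot
    exact (hmax W' hW').not_gt hlt
  · obtain ⟨W', hW', hlt⟩ := exists_expThiele_lt_of_notMem_topk hp hmono hnc hW₂ h₂
    exact hlt.trans_le (expThiele_le_of_mem_topk hp hmono hnc h₁ hW')
  · exact le_antisymm (expThiele_le_of_mem_topk hp hmono hnc h₂ (mem_topk.1 h₁).1)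
      (expThiele_le_of_mem_topk hp hmono hnc h₁ (mem_topk.1 h₂).1)
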